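/- (Laplacian formula in canonical form.) Let V ⊆ ℂ^m be open, let h : V → ℂ^m and M : V → so(m,ℂ) be holomorphic, and set F(q,z) = q − M(z)q̄ − h(z) for q ∈ ℂ^m, z ∈ V. Let z : U → V be a smooth map on an open set U ⊆ ℂ^m with F(q, z(q)) = 0 for all q ∈ U and with K(q) = (∂F^a/∂z^b)(q, z(q)) invertible for all q ∈ U. Then for each a = 1,…,m, (1/4)Δz^a = ((−1)^a / det K) · Σ_{1 ≤ i < j ≤ m} (−1)^{i+j−1} · D^a_{ij}, where D^a_{ij} is the determinant of the (m−1)×(m−1) matrix whose first row is the vector (∂M^i_{j̄}/∂z^b)(z(q)) for b = 1,…,m with the entry b = a omitted, and whose remaining m−2 rows are the rows (K^{k}_b)_{b≠a} of K for k running through {1,…,m}\{i,j} in increasing order. -/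

import Mathlib

open Complex BigOperators Matrix

/-- Partial derivative in the direction of the real coordinate `x^{2j-1}`,
identifying `ℝ^{2m} ≅ ℂ^m` via `q^j = x^{2j-1} + i x^{2j}`. -/
noncomputable def pdRe {m : ℕ} (f : (Fin m → ℂ) → ℂ) (j : Fin m) (x : Fin m → ℂ) : ℂ :=
  fderiv ℝ f x (Pi.single j 1)

/-- Partial derivative in the direction of the real coordinate `x^{2j}`. -/
noncomputable def pdIm {m : ℕ} (f : (Fin m → ℂ) → ℂ) (j : Fin m) (x : Fin m → ℂ) : ℂ :=
  fderiv ℝ f x (Pi.single j Complex.I)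

/-- Wirtinger derivative `∂f/∂q^j = ½(∂f/∂x^{2j-1} − i ∂f/∂x^{2j})`. -/
noncomputable def wdq {m : ℕ} (f : (Fin m → ℂ) → ℂ) (j : Fin m) (x : Fin m → ℂ) : ℂ :=
  (pdRe f j x - Complex.I * pdIm f j x) / 2

/-- Wirtinger derivative `∂f/∂q̄^j = ½(∂f/∂x^{2j-1} + i ∂f/∂x^{2j})`. -/
noncomputable def wdqbar {m : ℕ} (f : (Fin m → ℂ) → ℂ) (j : Fin m) (x : Fin m → ℂ) : ℂ :=
  (pdRe f j x + Complex.I * pdIm f j x) / 2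

/-- Laplacian `Δf = Σ_{i=1}^{2m} ∂²f/(∂x^i)²`. -/
noncomputable def lap {m : ℕ} (f : (Fin m → ℂ) → ℂ) (x : Fin m → ℂ) : ℂ :=
  ∑ j, (pdRe (fun y => pdRe f j y) j x + pdIm (fun y => pdIm f j y) j x)

/-- The horizontal weak conformality quantity `Σ_{i=1}^{2m} (∂f/∂x^i)²`. -/
noncomputable def hwc {m : ℕ} (f : (Fin m → ℂ) → ℂ) (x : Fin m → ℂ) : ℂ :=
  ∑ j, ((pdRe f j x) ^ 2 + (pdIm f j x) ^ 2)

/-- The strictly increasing enumeration `Fin (m-2) → Fin m` of the complement of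
`{i, j}` (junk value if `i = j`). -/
noncomputable def delTwo {m : ℕ} (i j : Fin m) : Fin (m - 2) → Fin m :=
  if h : ({i, j}ᶜ : Finset (Fin m)).card = m - 2 then
    fun r => (({i, j}ᶜ : Finset (Fin m)).orderIsoOfFin h r : Fin m)
  else fun r => ⟨r.val, lt_of_lt_of_le r.isLt (Nat.sub_le m 2)⟩

/-- The strictly increasing enumeration `Fin (m-1) → Fin m` of the complement of
`{a}`. -/
noncomputable def delOne {m : ℕ} (a : Fin m) : Fin (m - 1) → Fin m :=
  if h : ({a}ᶜ : Finset (Fin m)).card = m - 1 then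
    fun r => (({a}ᶜ : Finset (Fin m)).orderIsoOfFin h r : Fin m)
  else fun r => ⟨r.val, lt_of_lt_of_le r.isLt (Nat.sub_le m 1)⟩


theorem aux_delOne {n : ℕ} (a : Fin (n+2)) (c : Fin (n+1)) :
    delOne a c = a.succAbove c := by
  unfold delOne
  have h : ({a}ᶜ : Finset (Fin (n+2))).card = n + 2 - 1 := by
    rw [Finset.card_compl]; simp
  rw [dif_pos h]
  have := Finset.orderEmbOfFin_unique (s := ({a}ᶜ : Finset (Fin (n+2)))) h
    (f := fun c : Fin (n+1) => a.succAbove c) (by intro x; simp [Fin.succAbove_ne])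
    (Fin.strictMono_succAbove a)
  exact (congrFun this c).symm

theorem aux_delTwo {n : ℕ} (i : Fin (n+2)) (j' : Fin (n+1)) (c : Fin n) :
    delTwo i (i.succAbove j') c = i.succAbove (j'.succAbove c) := by
  unfold delTwo
  have h : ({i, i.succAbove j'}ᶜ : Finset (Fin (n+2))).card = n + 2 - 2 := by
    rw [Finset.card_compl, Finset.card_pair (Fin.succAbove_ne i j').symm]; simp
  rw [dif_pos h]
  have := Finset.orderEmbOfFin_unique (s := ({i, i.succAbove j'}ᶜ : Finset (Fin (n+2)))) h
    (f := fun c : Fin n => i.succAbove (j'.succAbove c))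
    (by intro x; simp [Fin.succAbove_ne])
    ((Fin.strictMono_succAbove i).comp (Fin.strictMono_succAbove j'))
  exact (congrFun this c).symm

theorem aux_minor0 {n : ℕ} (K : Matrix (Fin (n+2)) (Fin (n+2)) ℂ) (w : Fin (n+2) → ℂ)
    (a i j : Fin (n+2)) (hij : i < j) :
    ((K.updateRow i (Pi.single a 1)).updateRow j w).det =
      (-1 : ℂ) ^ ((a : ℕ) + (i : ℕ) + (j : ℕ) + 1) *
        (Matrix.of (fun r c : Fin (n + 1) =>
                if hr : (r : ℕ) = 0 then w (delOne a c)
                else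
                  K (delTwo i j ⟨(r : ℕ) - 1, by have := r.isLt; omega⟩)
                    (delOne a c))).det := by
  obtain ⟨j', rfl⟩ := Fin.exists_succAbove_eq hij.ne'
  have hj' : ((i.succAbove j' : Fin (n+2)) : ℕ) = (j' : ℕ) + 1 := by
    rw [Fin.succAbove_of_le_castSucc]
    · simp
    · by_contra hc
      push Not at hc
      rw [Fin.succAbove_of_castSucc_lt _ _ hc] at hij
      exact absurd hij (not_lt.mpr hc.le)
  rw [Matrix.det_succ_row _ i, Finset.sum_eq_single a]
  rotate_left
  · intro b _ hb
    rw [Matrix.updateRow_ne (Fin.succAbove_ne i j').symm]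
    simp [hb]
  · simp
  rw [Matrix.updateRow_ne (Fin.succAbove_ne i j').symm, Matrix.updateRow_self, Pi.single_eq_same,
    Matrix.det_succ_row _ j', 
    Matrix.det_succ_row (Matrix.of _) 0,
    hj', Finset.mul_sum, Finset.mul_sum]
  refine Finset.sum_congr rfl fun b _ => ?_
  have e : (((K.updateRow i (Pi.single a 1)).updateRow (i.succAbove j') w).submatrix i.succAbove
      a.succAbove).submatrix j'.succAbove b.succAbove =
      (Matrix.of (fun r c : Fin (n + 1) =>
                if hr : (r : ℕ) = 0 then w (delOne a c)
                else
                  K (delTwo i (i.succAbove j') ⟨(r : ℕ) - 1, by have := r.isLt; omega⟩)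
                    (delOne a c))).submatrix (Fin.succAbove 0) b.succAbove := by
    ext r c
    simp only [Matrix.submatrix_apply, Matrix.of_apply]
    rw [dif_neg (by simp), Matrix.updateRow_ne, Matrix.updateRow_ne (Fin.succAbove_ne _ _),
      aux_delOne]
    · exact congrArg (fun t => K t (a.succAbove (b.succAbove c))) (aux_delTwo i j' r).symm
    · intro hc
      exact Fin.succAbove_ne _ _ (Fin.succAbove_right_injective hc)
  rw [e]
  simp only [Matrix.submatrix_apply, Matrix.of_apply, Matrix.updateRow_self]
  rw [dif_pos (by simp), aux_delOne]
  simp only [Fin.val_zero, zero_add]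
  have hs : (-1 : ℂ) ^ ((a : ℕ) + i + (j' + 1) + 1) = (-1) ^ ((i : ℕ) + a) * (-1) ^ (j' : ℕ) := by
    ring
  rw [hs]
  ring

theorem aux_minor {n : ℕ} (K : Matrix (Fin (n+2)) (Fin (n+2)) ℂ) (w : Fin (n+2) → ℂ)
    (a i j : Fin (n+2)) (hij : i < j) :
    ((K.updateRow i (Pi.single a 1)).updateRow j w).det =
      (-1 : ℂ) ^ ((a : ℕ) + (i : ℕ) + (j : ℕ) + 1) *
        (Matrix.of (fun r c : Fin (n + 2 - 1) =>
                if hr : (r : ℕ) = 0 then w (delOne a c)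
                else
                  K (delTwo i j ⟨(r : ℕ) - 1, by have := r.isLt; omega⟩)
                    (delOne a c))).det :=
  aux_minor0 K w a i j hij

theorem aux_jacobi {m : ℕ} (K : Matrix (Fin m) (Fin m) ℂ) (w : Fin m → ℂ) (hK : K.det ≠ 0)
    (a i j : Fin m) (hij : i ≠ j) :
    ((K.updateRow i (Pi.single a 1)).updateRow j w).det =
      K.det * (K⁻¹ a i * (w ᵥ* K⁻¹) j - K⁻¹ a j * (w ᵥ* K⁻¹) i) := by
  have hu : IsUnit K.det := hK.isUnit
  have hadj : ∀ b, (K.updateRow b (Pi.single a 1)).det = K.det * K⁻¹ a b := by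
    intro b
    rw [← Matrix.adjugate_apply, Matrix.inv_def]
    simp [hK]
  set u := w ᵥ* K⁻¹ with hudef
  set A := K.updateRow i (Pi.single a 1) with hA
  have hw : w = ∑ k, (if k = i then 0 else u k) • A k + u i • K i := by
    have h1 : w = u ᵥ* K := by
      rw [hudef, Matrix.vecMul_vecMul, Matrix.nonsing_inv_mul _ hu, Matrix.vecMul_one]
    have h2 : u ᵥ* K = ∑ k, u k • K k := by
      ext b; simp [Matrix.vecMul, dotProduct, Finset.sum_apply]
    have h3 : ∑ k, (if k = i then 0 else u k) • A k = ∑ k, (if k = i then 0 else u k • K k) := by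
      refine Finset.sum_congr rfl fun k _ => ?_
      split_ifs with hk
      · simp
      · congr 1
        ext b
        rw [hA, Matrix.updateRow_ne hk]
    rw [h1.trans h2, h3, ← Finset.add_sum_erase _ _ (Finset.mem_univ i), add_comm]
    congr 1
    rw [← Finset.add_sum_erase (Finset.univ) (fun k => if k = i then 0 else u k • K k)
      (Finset.mem_univ i)]
    simp only [if_true, zero_add]
    refine Finset.sum_congr rfl fun k hk => ?_
    rw [if_neg (Finset.ne_of_mem_erase hk)]
  have hsw : (A.updateRow j (K i)).det = - (K.updateRow j (Pi.single a 1)).det := by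
    have : A.updateRow j (K i) =
        (K.updateRow j (Pi.single a 1)).submatrix (Equiv.swap i j) id := by
      ext r c
      simp only [Matrix.submatrix_apply, id]
      by_cases hr : r = j
      · subst hr
        rw [Matrix.updateRow_self, Equiv.swap_apply_right, Matrix.updateRow_ne hij]
      · rw [Matrix.updateRow_ne hr]
        by_cases hr' : r = i
        · subst hr'
          rw [hA, Matrix.updateRow_self, Equiv.swap_apply_left, Matrix.updateRow_self]
        · rw [hA, Matrix.updateRow_ne hr', Equiv.swap_apply_of_ne_of_ne hr' hr,
            Matrix.updateRow_ne hr]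
    rw [this, Matrix.det_permute, Equiv.Perm.sign_swap hij]
    simp
  conv_lhs => rw [hw]
  rw [Matrix.det_updateRow_add, Matrix.det_updateRow_sum, Matrix.det_updateRow_smul, hsw, hA,
    hadj, hadj, if_neg hij.symm]
  simp only [smul_eq_mul]
  ring

theorem wdq_of {m : ℕ} {f : (Fin m → ℂ) → ℂ} {f' : (Fin m → ℂ) →L[ℝ] ℂ} {x : Fin m → ℂ}
    (hf : HasFDerivAt f f' x) (j : Fin m) :
    wdq f j x = (f' (Pi.single j 1) - Complex.I * f' (Pi.single j Complex.I)) / 2 := by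
  simp [wdq, pdRe, pdIm, hf.fderiv]

theorem pd_hasFDerivAt {m : ℕ} {f : (Fin m → ℂ) → ℂ} {q : Fin m → ℂ} (hf : ContDiffAt ℝ 2 f q)
    (v : Fin m → ℂ) : HasFDerivAt (fun x => fderiv ℝ f x v)
      ((ContinuousLinearMap.apply ℝ ℂ v).comp (fderiv ℝ (fderiv ℝ f) q)) q := by
  have h1 : DifferentiableAt ℝ (fderiv ℝ f) q :=
    (hf.fderiv_right (m := 1) (by norm_num)).differentiableAt (by norm_num)
  exact (ContinuousLinearMap.apply ℝ ℂ v).hasFDerivAt.comp q h1.hasFDerivAt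

theorem second_symm {m : ℕ} {f : (Fin m → ℂ) → ℂ} {q : Fin m → ℂ} (hf : ContDiffAt ℝ 2 f q)
    (u v : Fin m → ℂ) : fderiv ℝ (fderiv ℝ f) q u v = fderiv ℝ (fderiv ℝ f) q v u := by
  have := hf.isSymmSndFDerivAt (by simp)
  exact this u v

theorem wdq_hasFDerivAt {m : ℕ} {f : (Fin m → ℂ) → ℂ} {q : Fin m → ℂ} (hf : ContDiffAt ℝ 2 f q)
    (k : Fin m) : ∃ L : (Fin m → ℂ) →L[ℝ] ℂ, HasFDerivAt (fun x => wdq f k x) L q ∧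
      ∀ v, L v = (fderiv ℝ (fderiv ℝ f) q v (Pi.single k 1)
        - Complex.I * fderiv ℝ (fderiv ℝ f) q v (Pi.single k Complex.I)) / 2 := by
  refine ⟨_, (((pd_hasFDerivAt hf (Pi.single k 1)).sub
    ((pd_hasFDerivAt hf (Pi.single k Complex.I)).const_mul Complex.I)).mul_const (2⁻¹ : ℂ)), ?_⟩
  intro v
  simp
  ring

theorem wdqbar_hasFDerivAt {m : ℕ} {f : (Fin m → ℂ) → ℂ} {q : Fin m → ℂ} (hf : ContDiffAt ℝ 2 f q)
    (k : Fin m) : ∃ L : (Fin m → ℂ) →L[ℝ] ℂ, HasFDerivAt (fun x => wdqbar f k x) L q ∧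
      ∀ v, L v = (fderiv ℝ (fderiv ℝ f) q v (Pi.single k 1)
        + Complex.I * fderiv ℝ (fderiv ℝ f) q v (Pi.single k Complex.I)) / 2 := by
  refine ⟨_, (((pd_hasFDerivAt hf (Pi.single k 1)).add
    ((pd_hasFDerivAt hf (Pi.single k Complex.I)).const_mul Complex.I)).mul_const (2⁻¹ : ℂ)), ?_⟩
  intro v
  simp
  ring

theorem lap_eq {m : ℕ} {f : (Fin m → ℂ) → ℂ} {q : Fin m → ℂ} (hf : ContDiffAt ℝ 2 f q) :
    (1/4 : ℂ) * lap f q = ∑ j, wdq (fun x => wdqbar f j x) j q := by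
  unfold lap
  rw [Finset.mul_sum]
  refine Finset.sum_congr rfl fun j _ => ?_
  obtain ⟨L, hL, hLv⟩ := wdqbar_hasFDerivAt hf j
  rw [wdq_of hL, hLv, hLv, second_symm hf (Pi.single j Complex.I) (Pi.single j 1)]
  have h1 : pdRe (fun y => pdRe f j y) j q
      = fderiv ℝ (fderiv ℝ f) q (Pi.single j 1) (Pi.single j 1) := by
    unfold pdRe; rw [(pd_hasFDerivAt hf _).fderiv]; rfl
  have h2 : pdIm (fun y => pdIm f j y) j q
      = fderiv ℝ (fderiv ℝ f) q (Pi.single j Complex.I) (Pi.single j Complex.I) := by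
    unfold pdIm; rw [(pd_hasFDerivAt hf _).fderiv]; rfl
  rw [h1, h2]
  linear_combination (-(1/4 : ℂ) * (fderiv ℝ (fderiv ℝ f) q (Pi.single j Complex.I) (Pi.single j Complex.I))) * (-Complex.I_sq)

theorem wdq_wdq_symm {m : ℕ} {f : (Fin m → ℂ) → ℂ} {q : Fin m → ℂ} (hf : ContDiffAt ℝ 2 f q)
    (j k : Fin m) : wdq (fun x => wdq f k x) j q = wdq (fun x => wdq f j x) k q := by
  obtain ⟨L, hL, hLv⟩ := wdq_hasFDerivAt hf j
  obtain ⟨L', hL', hLv'⟩ := wdq_hasFDerivAt hf k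
  rw [wdq_of hL, wdq_of hL', hLv, hLv, hLv', hLv', second_symm hf (Pi.single j Complex.I),
    second_symm hf (Pi.single j Complex.I), second_symm hf (Pi.single j 1),
    second_symm hf (Pi.single j 1)]
  ring

theorem wdq_neg_sum_mul {m : ℕ} {q : Fin m → ℂ} (f g : Fin m → (Fin m → ℂ) → ℂ)
    (hf : ∀ k, DifferentiableAt ℝ (f k) q) (hg : ∀ k, DifferentiableAt ℝ (g k) q) (j : Fin m) :
    wdq (fun x => - ∑ k, f k x * g k x) j q
      = - ∑ k, (wdq (f k) j q * g k q + f k q * wdq (g k) j q) := by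
  have := (HasFDerivAt.fun_sum (u := Finset.univ)
    (fun k _ => (hf k).hasFDerivAt.mul (hg k).hasFDerivAt)).neg
  rw [wdq_of (f := fun x => - ∑ k, f k x * g k x) this]
  simp only [wdq, pdRe, pdIm, ContinuousLinearMap.neg_apply, ContinuousLinearMap.sum_apply,
    ContinuousLinearMap.add_apply, ContinuousLinearMap.smul_apply, smul_eq_mul]
  rw [mul_neg, sub_neg_eq_add, Finset.mul_sum, neg_add_eq_sub, ← Finset.sum_sub_distrib,
    Finset.sum_div, ← Finset.sum_neg_distrib]
  refine Finset.sum_congr rfl fun k _ => ?_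
  ring

theorem clin_expand {m : ℕ} (L : (Fin m → ℂ) →L[ℂ] ℂ) (v : Fin m → ℂ) :
    L v = ∑ b, L (Pi.single b 1) * v b := by
  conv_lhs => rw [← Finset.univ_sum_single v, map_sum]
  refine Finset.sum_congr rfl fun b _ => ?_
  rw [show Pi.single b (v b) = v b • (Pi.single b (1:ℂ) : Fin m → ℂ) by
    rw [← Pi.single_smul]; simp, map_smul, smul_eq_mul, mul_comm]

theorem wdq_comp {m : ℕ} {q : Fin m → ℂ} {z : (Fin m → ℂ) → Fin m → ℂ} {g : (Fin m → ℂ) → ℂ}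
    (hg : DifferentiableAt ℂ g (z q)) (hz : DifferentiableAt ℝ z q) (j : Fin m) :
    DifferentiableAt ℝ (fun x => g (z x)) q ∧
    wdq (fun x => g (z x)) j q = ∑ c, fderiv ℂ g (z q) (Pi.single c 1) * wdq (fun x => z x c) j q := by
  have hc := (hg.hasFDerivAt.restrictScalars ℝ).comp q hz.hasFDerivAt
  refine ⟨hc.differentiableAt, ?_⟩
  rw [wdq_of (f := fun x => g (z x)) hc]
  have hzc : ∀ c, HasFDerivAt (fun x => z x c) ((ContinuousLinearMap.proj c).comp (fderiv ℝ z q)) q :=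
    fun c => hasFDerivAt_pi'.1 hz.hasFDerivAt c
  simp only [fun c => wdq_of (hzc c) j, ContinuousLinearMap.comp_apply,
    ContinuousLinearMap.coe_restrictScalars', ContinuousLinearMap.proj_apply]
  rw [clin_expand _ (fderiv ℝ z q (Pi.single j 1)), clin_expand _ (fderiv ℝ z q (Pi.single j I)),
    Finset.mul_sum, ← Finset.sum_sub_distrib, Finset.sum_div]
  refine Finset.sum_congr rfl fun k _ => ?_
  ring

theorem first_order {m : ℕ}
    (V : Set (Fin m → ℂ)) (hV : IsOpen V)
    (h : (Fin m → ℂ) → Fin m → ℂ) (hh : DifferentiableOn ℂ h V)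
    (M : (Fin m → ℂ) → Matrix (Fin m) (Fin m) ℂ)
    (hM : ∀ i j, DifferentiableOn ℂ (fun w => M w i j) V)
    (F : (Fin m → ℂ) → (Fin m → ℂ) → Fin m → ℂ)
    (hF : ∀ q z, F q z = q - (M z).mulVec (fun i => starRingEnd ℂ (q i)) - h z)
    (U : Set (Fin m → ℂ)) (hU : IsOpen U)
    (z : (Fin m → ℂ) → Fin m → ℂ) (hz : ContDiffOn ℝ (⊤ : ℕ∞) z U)
    (hzV : Set.MapsTo z U V)
    (hsol : ∀ q ∈ U, F q (z q) = 0)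
    (K : (Fin m → ℂ) → Matrix (Fin m) (Fin m) ℂ)
    (hK : ∀ q a b, K q a b = fderiv ℂ (fun zz => F q zz a) (z q) (Pi.single b 1))
    (hKdet : ∀ q ∈ U, (K q).det ≠ 0) (q : Fin m → ℂ) (hq : q ∈ U) (v : Fin m → ℂ) :
    fderiv ℝ z q v = (K q)⁻¹ *ᵥ (M (z q) *ᵥ (fun i => starRingEnd ℂ (v i)) - v) := by
  have hzq : HasFDerivAt z (fderiv ℝ z q) q :=
    ((hz.contDiffAt (hU.mem_nhds hq)).differentiableAt (by simp)).hasFDerivAt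
  have hVz := hV.mem_nhds (hzV hq)
  have hMd : ∀ i j, HasFDerivAt (fun w => M w i j) (fderiv ℂ (fun w => M w i j) (z q)) (z q) :=
    fun i j => ((hM i j).differentiableAt hVz).hasFDerivAt
  have hhd : ∀ i, HasFDerivAt (fun w => h w i) (fderiv ℂ (fun w => h w i) (z q)) (z q) :=
    fun i => ((differentiableAt_pi.1 (hh.differentiableAt hVz)) i).hasFDerivAt
  have key : K q *ᵥ (fderiv ℝ z q v) = M (z q) *ᵥ (fun i => starRingEnd ℂ (v i)) - v := by
    ext a
    -- the `z`-derivative of `F`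
    have hFz : HasFDerivAt (fun zz => F q zz a)
        (-(∑ j, (starRingEnd ℂ (q j)) • fderiv ℂ (fun w => M w a j) (z q))
          - fderiv ℂ (fun w => h w a) (z q)) (z q) := by
      have e : (fun zz => F q zz a)
          = fun zz => q a - (∑ j, M zz a j * starRingEnd ℂ (q j)) - h zz a := by
        funext zz; rw [hF]; rfl
      rw [e]
      exact ((HasFDerivAt.fun_sum (u := Finset.univ)
        (fun j _ => (hMd a j).mul_const (starRingEnd ℂ (q j)))).const_sub (q a)).sub (hhd a)
    have hKv : (K q *ᵥ (fderiv ℝ z q v)) a =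
        (-(∑ j, (starRingEnd ℂ (q j)) • fderiv ℂ (fun w => M w a j) (z q))
          - fderiv ℂ (fun w => h w a) (z q)) (fderiv ℝ z q v) := by
      rw [clin_expand _ (fderiv ℝ z q v)]
      simp only [Matrix.mulVec, dotProduct, hK, hFz.fderiv]
    -- total derivative
    have hconj : ∀ j, HasFDerivAt (fun x : Fin m → ℂ => starRingEnd ℂ (x j))
        ((Complex.conjCLE : ℂ →L[ℝ] ℂ).comp (ContinuousLinearMap.proj j)) q := fun j =>
      ((Complex.conjCLE : ℂ →L[ℝ] ℂ).comp
        (ContinuousLinearMap.proj (R := ℝ) (φ := fun _ : Fin m => ℂ) j)).hasFDerivAt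
    have htot := ((hasFDerivAt_apply (𝕜 := ℝ) a q).sub (HasFDerivAt.fun_sum (u := Finset.univ)
        (fun j _ => (((hMd a j).restrictScalars ℝ).comp q hzq).mul (hconj j)))).sub
        (((hhd a).restrictScalars ℝ).comp q hzq)
    have hzero := htot.congr_of_eventuallyEq (f₁ := fun _ => (0 : ℂ)) (by
      filter_upwards [hU.mem_nhds hq] with x hx
      have := congrFun (hsol x hx) a
      rw [hF] at this
      exact this.symm)
    have h0 := congrArg (fun L => L v) (hzero.unique (hasFDerivAt_const (0 : ℂ) q))
    rw [hKv]
    simp [Finset.sum_add_distrib] at h0 ⊢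
    simp only [Matrix.mulVec, dotProduct]
    linear_combination h0
  rw [← key, Matrix.mulVec_mulVec, Matrix.nonsing_inv_mul _ (hKdet q hq).isUnit,
    Matrix.one_mulVec]


theorem double_skew {m : ℕ} (S T : Fin m → Fin m → ℂ) (hS : ∀ j k, S j k = S k j)
    (hT : ∀ j k, T j k = - T k j) : ∑ j, ∑ k, S j k * T j k = 0 := by
  have h : ∑ j, ∑ k, S j k * T j k = - ∑ j, ∑ k, S j k * T j k := by
    conv_lhs => rw [Finset.sum_comm]
    rw [← Finset.sum_neg_distrib]
    refine Finset.sum_congr rfl fun j _ => ?_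
    rw [← Finset.sum_neg_distrib]
    refine Finset.sum_congr rfl fun k _ => ?_
    rw [hS k j, hT k j]; ring
  linear_combination h / 2

theorem sum_lt {m : ℕ} (f : Fin m → Fin m → ℂ) (hf : ∀ i, f i i = 0) :
    ∑ i, ∑ j, f i j = ∑ i, ∑ j, if i < j then f i j + f j i else 0 := by
  have h1 : ∀ i j, f i j = (if i < j then f i j else 0) + (if j < i then f i j else 0) := by
    intro i j
    rcases lt_trichotomy i j with h | h | h
    · simp [h, h.not_gt]
    · subst h; simp [hf]
    · simp [h, h.not_gt]
  have h2 : ∑ i, ∑ j, f i j = ∑ i, ∑ j, (if i < j then f i j else 0)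
      + ∑ i, ∑ j, (if j < i then f i j else 0) := by
    rw [← Finset.sum_add_distrib]
    refine Finset.sum_congr rfl fun i _ => ?_
    rw [← Finset.sum_add_distrib]
    exact Finset.sum_congr rfl fun j _ => h1 i j
  rw [h2, Finset.sum_comm (f := fun i j => if j < i then f i j else 0), ← Finset.sum_add_distrib]
  refine Finset.sum_congr rfl fun i _ => ?_
  rw [← Finset.sum_add_distrib]
  refine Finset.sum_congr rfl fun j _ => ?_
  split_ifs <;> simp

theorem fderiv_skew {m : ℕ} {V : Set (Fin m → ℂ)} (hV : IsOpen V)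
    (M : (Fin m → ℂ) → Matrix (Fin m) (Fin m) ℂ)
    (hskew : ∀ v ∈ V, (M v)ᵀ = -(M v)) (p : Fin m → ℂ) (hp : p ∈ V) (i j : Fin m) :
    fderiv ℂ (fun w => M w i j) p = - fderiv ℂ (fun w => M w j i) p := by
  have : (fun w => M w i j) =ᶠ[nhds p] fun w => - M w j i := by
    filter_upwards [hV.mem_nhds hp] with w hw
    exact congrFun (congrFun (hskew w hw) j) i
  rw [this.fderiv_eq, fderiv_fun_neg]

theorem wdq_congr {m : ℕ} {f g : (Fin m → ℂ) → ℂ} {q : Fin m → ℂ} (h : f =ᶠ[nhds q] g)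
    (j : Fin m) : wdq f j q = wdq g j q := by
  simp [wdq, pdRe, pdIm, h.fderiv_eq]

/-- Laplacian formula in canonical form: for a smooth solution `z`
of `F(q, z(q)) = 0`, where `F(q,z) = q − M(z)q̄ − h(z)` with `h, M` holomorphic
and `K = (∂F^a/∂z^b)` invertible along `z`, one has (with 0-based indices, so
that the 1-based signs `(−1)^a` and `(−1)^{i+j−1}` become `(−1)^{a+1}` and
`(−1)^{i+j+1}`):
`(1/4)Δz^a = ((−1)^{a+1}/det K) Σ_{i<j} (−1)^{i+j+1} D^a_{ij}`,
where `D^a_{ij}` is the determinant of the `(m−1)×(m−1)` matrix whose first row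
is `(∂M^i_{j̄}/∂z^b)_{b≠a}` and whose remaining rows are the rows `(K^k_b)_{b≠a}`
for `k ∉ {i,j}` in increasing order. -/
theorem laplacian_canonical_form {m : ℕ}
    (V : Set (Fin m → ℂ)) (hV : IsOpen V)
    (h : (Fin m → ℂ) → Fin m → ℂ) (hh : DifferentiableOn ℂ h V)
    (M : (Fin m → ℂ) → Matrix (Fin m) (Fin m) ℂ)
    (hskew : ∀ v ∈ V, (M v)ᵀ = -(M v))
    (hM : ∀ i j, DifferentiableOn ℂ (fun w => M w i j) V)
    (F : (Fin m → ℂ) → (Fin m → ℂ) → Fin m → ℂ)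
    (hF : ∀ q z, F q z = q - (M z).mulVec (fun i => starRingEnd ℂ (q i)) - h z)
    (U : Set (Fin m → ℂ)) (hU : IsOpen U)
    (z : (Fin m → ℂ) → Fin m → ℂ) (hz : ContDiffOn ℝ (⊤ : ℕ∞) z U)
    (hzV : Set.MapsTo z U V)
    (hsol : ∀ q ∈ U, F q (z q) = 0)
    (K : (Fin m → ℂ) → Matrix (Fin m) (Fin m) ℂ)
    (hK : ∀ q a b, K q a b = fderiv ℂ (fun zz => F q zz a) (z q) (Pi.single b 1))
    (hKdet : ∀ q ∈ U, (K q).det ≠ 0) :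
    ∀ q ∈ U, ∀ a : Fin m,
      (1/4 : ℂ) * lap (fun x => z x a) q
        = ((-1 : ℂ) ^ ((a : ℕ) + 1) / (K q).det) *
          ∑ i : Fin m, ∑ j : Fin m,
            (if i < j then
              (-1 : ℂ) ^ ((i : ℕ) + (j : ℕ) + 1) *
              (Matrix.of (fun r c : Fin (m - 1) =>
                if hr : (r : ℕ) = 0 then
                  fderiv ℂ (fun w => M w i j) (z q) (Pi.single (delOne a c) 1)
                else
                  K q (delTwo i j ⟨(r : ℕ) - 1, by have := r.isLt; omega⟩)
                    (delOne a c))).det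
            else 0) := by
  intro q hq a
  have hzc : ∀ x ∈ U, ∀ b, ContDiffAt ℝ 2 (fun y => z y b) x := fun x hx b =>
    (contDiffAt_pi.1 (hz.contDiffAt (hU.mem_nhds hx)) b).of_le (WithTop.coe_le_coe.2 (le_top : (2 : ℕ∞) ≤ ⊤))
  have hzd : ∀ x ∈ U, DifferentiableAt ℝ z x := fun x hx =>
    (hz.contDiffAt (hU.mem_nhds hx)).differentiableAt (by simp)
  have hfd : ∀ x ∈ U, ∀ b v, fderiv ℝ (fun y => z y b) x v =
      ((K x)⁻¹ *ᵥ (M (z x) *ᵥ (fun i => starRingEnd ℂ (v i)) - v)) b := by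
    intro x hx b v
    rw [← first_order V hV h hh M hM F hF U hU z hz hzV hsol K hK hKdet x hx v,
      (hasFDerivAt_pi'.1 (hzd x hx).hasFDerivAt b).fderiv]
    rfl
  have c1 : ∀ k : Fin m, (fun i => starRingEnd ℂ ((Pi.single k 1 : Fin m → ℂ) i))
      = Pi.single k 1 := by
    intro k; ext i; by_cases hi : i = k
    · subst hi; simp
    · simp [hi]
  have c2 : ∀ k : Fin m, (fun i => starRingEnd ℂ ((Pi.single k Complex.I : Fin m → ℂ) i))
      = (-Complex.I) • Pi.single k (1 : ℂ) := by
    intro k; ext i; by_cases hi : i = k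
    · subst hi; simp
    · simp [hi]
  have c3 : ∀ k : Fin m, (Pi.single k Complex.I : Fin m → ℂ)
      = Complex.I • Pi.single k (1 : ℂ) := by
    intro k; ext i; by_cases hi : i = k
    · subst hi; simp
    · simp [hi]
  have hre : ∀ x ∈ U, ∀ b k, pdRe (fun y => z y b) k x =
      ((K x)⁻¹ * M (z x)) b k - (K x)⁻¹ b k := by
    intro x hx b k
    rw [pdRe, hfd x hx, c1, Matrix.mulVec_sub, Matrix.mulVec_mulVec]
    simp
  have him : ∀ x ∈ U, ∀ b k, pdIm (fun y => z y b) k x =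
      -Complex.I * ((K x)⁻¹ * M (z x)) b k - Complex.I * (K x)⁻¹ b k := by
    intro x hx b k
    rw [pdIm, hfd x hx, c2, c3, Matrix.mulVec_sub, Matrix.mulVec_mulVec, Matrix.mulVec_smul,
      Matrix.mulVec_smul]
    simp
  have hA : ∀ x ∈ U, ∀ b k, wdq (fun y => z y b) k x = - (K x)⁻¹ b k := by
    intro x hx b k
    rw [wdq, hre x hx, him x hx]
    linear_combination (((K x)⁻¹ * M (z x)) b k + (K x)⁻¹ b k) / 2 * Complex.I_sq
  have hB : ∀ x ∈ U, ∀ b k, wdqbar (fun y => z y b) k x = ((K x)⁻¹ * M (z x)) b k := by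
    intro x hx b k
    rw [wdqbar, hre x hx, him x hx]
    linear_combination (-((K x)⁻¹ * M (z x)) b k - (K x)⁻¹ b k) / 2 * Complex.I_sq
  have hBA : ∀ j, (fun x => wdqbar (fun y => z y a) j x) =ᶠ[nhds q]
      fun x => - ∑ k, wdq (fun y => z y a) k x * M (z x) k j := by
    intro j
    filter_upwards [hU.mem_nhds hq] with x hx
    rw [hB x hx, Matrix.mul_apply, ← Finset.sum_neg_distrib]
    refine Finset.sum_congr rfl fun k _ => ?_
    rw [hA x hx]; ring
  have hMq : ∀ i j, DifferentiableAt ℂ (fun w => M w i j) (z q) := fun i j =>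
    (hM i j).differentiableAt (hV.mem_nhds (hzV hq))
  set P := (K q)⁻¹ with hP
  set dM : Fin m → Fin m → Fin m → ℂ :=
    fun i j b => fderiv ℂ (fun w => M w i j) (z q) (Pi.single b 1) with hdM
  have hdMs : ∀ i j b, dM i j b = - dM j i b := by
    intro i j b
    simp only [hdM]
    rw [fderiv_skew hV M hskew (z q) (hzV hq) i j]; rfl
  have hlap : (1/4 : ℂ) * lap (fun x => z x a) q
      = ∑ i, ∑ j, - (P a i * (dM i j ᵥ* P) j) := by
    rw [lap_eq (hzc q hq a)]
    have hj : ∀ j, wdq (fun x => wdqbar (fun y => z y a) j x) j q =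
        - (∑ k, wdq (fun x => wdq (fun y => z y a) k x) j q * M (z q) k j)
          + ∑ k, - (P a k * (dM k j ᵥ* P) j) := by
      intro j
      rw [wdq_congr (hBA j), wdq_neg_sum_mul (fun k x => wdq (fun y => z y a) k x)
        (fun k x => M (z x) k j)
        (fun k => (wdq_hasFDerivAt (hzc q hq a) k).choose_spec.1.differentiableAt)
        (fun k => (wdq_comp (hMq k j) (hzd q hq) j).1), Finset.sum_add_distrib, neg_add,
        ← Finset.sum_neg_distrib (f := fun k => wdq (fun y => z y a) k q * _)]
      congr 1
      refine Finset.sum_congr rfl fun k _ => ?_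
      rw [(wdq_comp (hMq k j) (hzd q hq) j).2, hA q hq]
      simp only [hA q hq, Matrix.vecMul, dotProduct, mul_neg, Finset.sum_neg_distrib]
      ring
    rw [Finset.sum_congr rfl fun j _ => hj j, Finset.sum_add_distrib, Finset.sum_neg_distrib,
      double_skew (fun j k => wdq (fun x => wdq (fun y => z y a) k x) j q)
        (fun j k => M (z q) k j) (fun j k => wdq_wdq_symm (hzc q hq a) j k)
        (fun j k => congrFun (congrFun (hskew _ (hzV hq)) j) k), neg_zero, zero_add,
      Finset.sum_comm]
  have hdiag : ∀ i b, dM i i b = 0 := by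
    intro i b
    linear_combination (hdMs i i b) / 2
  rw [hlap, sum_lt _ (fun i => by
    rw [show dM i i = 0 from funext (hdiag i)]; simp), Finset.mul_sum]
  refine Finset.sum_congr rfl fun i _ => ?_
  rw [Finset.mul_sum]
  refine Finset.sum_congr rfl fun j _ => ?_
  split_ifs with hij
  · have hm : 2 ≤ m := by
      have := j.isLt
      have : (i : ℕ) < j := hij
      omega
    obtain ⟨n, rfl⟩ : ∃ n, m = n + 2 := ⟨m - 2, by omega⟩
    have h1 := aux_minor (K q) (dM i j) a i j hij
    rw [aux_jacobi (K q) (dM i j) (hKdet q hq) a i j hij.ne] at h1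
    have h2 : dM j i = - dM i j := funext fun b => hdMs j i b
    rw [h2, Matrix.neg_vecMul]
    have hd := hKdet q hq
    set D := (Matrix.of (fun r c : Fin (n + 2 - 1) =>
                if hr : (r : ℕ) = 0 then dM i j (delOne a c)
                else
                  K q (delTwo i j ⟨(r : ℕ) - 1, by have := r.isLt; omega⟩)
                    (delOne a c))).det with hD
    rw [← hP] at h1
    have h3 : -(P a i * (dM i j ᵥ* P) j) + -(P a j * (-(dM i j ᵥ* P)) i)
        = - ((-1 : ℂ) ^ ((a : ℕ) + (i : ℕ) + (j : ℕ) + 1) * D) / (K q).det := by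
      rw [← h1]
      field_simp
      simp only [Pi.neg_apply]
      ring
    rw [h3]
    ring
  · simp
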